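/- arXiv:math-ph/0002010 — 2 statements merged into one kernel-verified Lean document; each statement's English description precedes it below -/
import Mathlib

section
/- Fix an odd prime p, and let f be a Schwartz function such that f̂ is compactly supported, f̂ ≥ 0 everywhere, and f̂(ξ) > 0 for all ξ ∈ [0,1]. Then (1/p^{2M}) Σ_{ℓ∈ℤ, ℓ≠0} f̂(2πℓ/p^M) |Σ_{j=1}^{p^M} exp(2πi ℓ j²/p^M)|² → ∞ as M → ∞. In particular, along the sequence N = p^M the pair correlation functionals of the quantized quadratic map do not converge to the Poisson limit f(0). -/
open MeasureTheory Filter Topology Real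

/-- Fourier transform with the convention `f̂(ξ) = ∫ f(x) e^{-i x ξ} dx`. -/
noncomputable def FT (f : ℝ → ℝ) (ξ : ℝ) : ℂ :=
  ∫ x : ℝ, (f x : ℂ) * Complex.exp (-(Complex.I * x * ξ))

open Finset in
theorem normSq_sum_stdAddChar_mul_sq {N : ℕ} [NeZero N] (hN : Odd N) (a : ZMod N) :
    ‖∑ x : ZMod N, ZMod.stdAddChar (a * x ^ 2)‖ ^ 2 =
      (N : ℝ) * #{h : ZMod N | a * h = 0} := by
  have h2 : IsUnit (2 : ZMod N) := by
    have := (ZMod.isUnit_iff_coprime 2 N).2 (Nat.coprime_two_left.2 hN)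
    exact_mod_cast this
  have key (h : ZMod N) : ∑ y : ZMod N, ZMod.stdAddChar (a * (y + h) ^ 2 - a * y ^ 2) =
      if a * h = 0 then (N : ℂ) else 0 := by
    have e (y : ZMod N) : ZMod.stdAddChar (a * (y + h) ^ 2 - a * y ^ 2) =
        ZMod.stdAddChar (a * h * h) * ZMod.stdAddChar (y * (2 * (a * h))) := by
      rw [← AddChar.map_add_eq_mul]; congr 1; ring
    simp_rw [e]
    rw [← mul_sum, AddChar.sum_mulShift _ (ZMod.isPrimitive_stdAddChar N)]
    by_cases h0 : a * h = 0 <;> simp [h0, h2.mul_right_eq_zero, ZMod.card]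
  apply Complex.ofReal_injective
  rw [Complex.ofReal_pow, ← Complex.mul_conj', map_sum, sum_mul_sum, sum_comm]
  calc _ = ∑ y : ZMod N, ∑ h : ZMod N, ZMod.stdAddChar (a * (y + h) ^ 2 - a * y ^ 2) := by
        refine sum_congr rfl fun y _ ↦ ?_
        rw [← Equiv.sum_comp (Equiv.addLeft y)]
        refine sum_congr rfl fun h _ ↦ ?_
        rw [← AddChar.map_neg_eq_conj, ← AddChar.map_add_eq_mul, sub_eq_add_neg]
        rfl
    _ = _ := by
        rw [sum_comm]
        simp_rw [key]
        rw [← sum_filter, sum_const, nsmul_eq_mul]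
        push_cast
        ring

open Finset in
theorem sum_Icc_natCast_zmod {N : ℕ} [NeZero N] {E : Type*} [AddCommMonoid E] (F : ZMod N → E) :
    ∑ j ∈ Icc 1 N, F (j : ZMod N) = ∑ x, F x := by
  refine sum_nbij (fun j ↦ (j : ZMod N)) (by simp) ?_ ?_ (fun _ _ ↦ rfl)
  · intro i hi j hj h
    have h' := (ZMod.natCast_eq_natCast_iff _ _ _).1 h
    simp only [coe_Icc, Set.mem_Icc] at hi hj
    exact h'.eq_of_abs_lt (by rw [abs_lt]; omega)
  · intro x _
    by_cases hx : x = 0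
    · exact ⟨N, by simp [NeZero.one_le], by simp [hx]⟩
    · refine ⟨x.val, ?_, ZMod.natCast_zmod_val x⟩
      have := x.val_lt
      have := (ZMod.val_ne_zero x).2 hx
      simp only [coe_Icc, Set.mem_Icc]
      omega

open Finset in
theorem gcd_le_card_mul_eq_zero {N : ℕ} [NeZero N] (l : ℕ) :
    l.gcd N ≤ #{h : ZMod N | (l : ZMod N) * h = 0} := by
  have hg : 0 < l.gcd N := Nat.gcd_pos_of_pos_right _ (NeZero.pos N)
  obtain ⟨m, hm⟩ := Nat.gcd_dvd_right l N
  obtain ⟨q, hq⟩ := Nat.gcd_dvd_left l N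
  set g := l.gcd N
  have hm0 : 0 < m := Nat.pos_of_ne_zero fun h ↦ NeZero.ne N (by simp [hm, h])
  conv_lhs => rw [← card_range g]
  refine card_le_card_of_injOn (fun i ↦ ((i * m : ℕ) : ZMod N)) ?_ ?_
  · intro i _
    simp only [coe_filter, mem_univ, true_and, Set.mem_ofPred_eq]
    rw [← Nat.cast_mul, ZMod.natCast_eq_zero_iff]
    exact ⟨q * i, by rw [hm]; nth_rewrite 1 [hq]; ring⟩
  · intro i hi j hj h
    simp only [coe_range, Set.mem_Iio] at hi hj
    have h' := (ZMod.natCast_eq_natCast_iff _ _ _).1 h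
    have lt {k : ℕ} (hk : k < g) : k * m < N := by
      rw [hm]; exact Nat.mul_lt_mul_of_pos_right hk hm0
    exact Nat.eq_of_mul_eq_mul_right hm0 (Nat.ModEq.eq_of_lt_of_lt h' (lt hi) (lt hj))

open Finset in
theorem le_sum_gcd_prime_pow {p : ℕ} (hp : p.Prime) {m M : ℕ} (hmM : m ≤ M) :
    (m + 1) * p ^ m ≤ 2 * ∑ l ∈ Icc 1 (p ^ m), l.gcd (p ^ M) := by
  have h1 (l : ℕ) : ∑ k ∈ range (m + 1), (if p ^ k ∣ l then (p ^ k).totient else 0) ≤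
      l.gcd (p ^ M) := by
    rw [← sum_filter, ← Nat.sum_totient (l.gcd (p ^ M)),
      ← sum_image (g := fun k ↦ p ^ k) (f := Nat.totient)
        (fun _ _ _ _ h ↦ Nat.pow_right_injective hp.two_le h)]
    refine sum_le_sum_of_subset fun d hd ↦ ?_
    obtain ⟨k, hk, rfl⟩ := mem_image.1 hd
    simp only [mem_filter, mem_range] at hk
    exact Nat.mem_divisors.2 ⟨Nat.dvd_gcd hk.2 (pow_dvd_pow _ (by omega)),
      (Nat.gcd_pos_of_pos_right _ (pow_pos hp.pos _)).ne'⟩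
  have h2 (k : ℕ) : p ^ k ≤ 2 * (p ^ k).totient := by
    rcases k.eq_zero_or_pos with rfl | hk
    · simp
    · obtain ⟨k, rfl⟩ := Nat.exists_eq_succ_of_ne_zero hk.ne'
      rw [Nat.totient_prime_pow hp hk, Nat.succ_sub_one, pow_succ]
      have := hp.two_le
      calc p ^ k * p ≤ p ^ k * (2 * (p - 1)) := Nat.mul_le_mul_left _ (by omega)
        _ = _ := by ring
  calc (m + 1) * p ^ m = ∑ k ∈ range (m + 1), p ^ m := by simp
    _ ≤ ∑ k ∈ range (m + 1), 2 * ∑ l ∈ Icc 1 (p ^ m),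
          (if p ^ k ∣ l then (p ^ k).totient else 0) := by
        refine sum_le_sum fun k hk ↦ ?_
        have hk : k ≤ m := by simpa [Nat.lt_succ_iff] using hk
        have hc : #{l ∈ Icc 1 (p ^ m) | p ^ k ∣ l} = p ^ (m - k) := by
          rw [← Nat.pow_div hk hp.pos, ← Nat.Ioc_filter_dvd_card_eq_div]
          rfl
        rw [← sum_filter, sum_const, hc, smul_eq_mul]
        calc p ^ m = p ^ (m - k) * p ^ k := by rw [← pow_add, Nat.sub_add_cancel hk]
          _ ≤ p ^ (m - k) * (2 * (p ^ k).totient) := Nat.mul_le_mul_left _ (h2 k)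
          _ = _ := by ring
    _ = 2 * ∑ l ∈ Icc 1 (p ^ m), ∑ k ∈ range (m + 1),
          (if p ^ k ∣ l then (p ^ k).totient else 0) := by rw [← mul_sum, sum_comm]
    _ ≤ _ := Nat.mul_le_mul_left _ (sum_le_sum fun l _ ↦ h1 l)

theorem continuous_FT (f : SchwartzMap ℝ ℝ) : Continuous (FT f) := by
  refine continuous_of_dominated (bound := fun x ↦ ‖f x‖) ?_ ?_ f.integrable.norm ?_
  · intro ξ
    have := f.continuous
    exact Continuous.aestronglyMeasurable (by fun_prop)
  · refine fun ξ ↦ ae_of_all _ fun x ↦ ?_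
    rw [norm_mul, Complex.norm_exp]
    simp
  · exact ae_of_all _ fun x ↦ by fun_prop

theorem finite_setOf_int_mul_ne_zero {E : Type*} [Zero E] {g : ℝ → E}
    (hg : HasCompactSupport g) {c : ℝ} (hc : c ≠ 0) : {l : ℤ | g (c * l) ≠ 0}.Finite := by
  have h : g =ᶠ[cocompact ℝ] 0 := by
    rw [hasCompactSupport_iff_eventuallyEq, coclosedCompact_eq_cocompact] at hg
    exact hg
  have ht : Tendsto (fun l : ℤ ↦ c * (l : ℝ)) cofinite (cocompact ℝ) :=
    (Homeomorph.mulLeft₀ c hc).isClosedEmbedding.tendsto_cocompact.comp Int.tendsto_coe_cofinite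
  exact Filter.eventually_cofinite.1 (ht.eventually h)

open Finset in
theorem mul_gcd_le_normSq_sum_exp {N : ℕ} [NeZero N] (hN : Odd N) (l : ℕ) :
    (N : ℝ) * l.gcd N ≤ ‖∑ j ∈ Finset.Icc 1 N, Complex.exp (Complex.I *
      ((2 * π * (l : ℝ) * (j : ℝ) ^ 2 / (N : ℝ) : ℝ) : ℂ))‖ ^ 2 := by
  have : ∑ j ∈ Finset.Icc 1 N, Complex.exp (Complex.I *
      ((2 * π * (l : ℝ) * (j : ℝ) ^ 2 / (N : ℝ) : ℝ) : ℂ)) =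
      ∑ x : ZMod N, ZMod.stdAddChar ((l : ZMod N) * x ^ 2) := by
    rw [← sum_Icc_natCast_zmod]
    refine sum_congr rfl fun j _ ↦ ?_
    have h := ZMod.stdAddChar_coe (N := N) (l * j ^ 2 : ℤ)
    push_cast at h
    rw [h]
    congr 1
    push_cast
    ring
  rw [this, normSq_sum_stdAddChar_mul_sq hN]
  gcongr
  exact gcd_le_card_mul_eq_zero l

open Finset in
theorem sum_re_mul_le_norm_tsum {g : ℝ → ℂ} (hg : HasCompactSupport g)
    (hre : ∀ ξ, 0 ≤ (g ξ).re) {a b : ℝ} (ha : a ≠ 0) (hb : b ≠ 0) (w : ℤ → ℝ)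
    (hw : ∀ l, 0 ≤ w l) (n : ℕ) :
    ∑ l ∈ Icc 1 n, (g (a * (l : ℝ) / b)).re * w l ≤
      ‖∑' l : ℤ, if l = 0 then 0 else g (a * l / b) * (w l : ℂ)‖ := by
  set F : ℤ → ℂ := fun l ↦ if l = 0 then 0 else g (a * l / b) * (w l : ℂ) with hF
  have hsum : Summable F := by
    refine summable_of_hasFiniteSupport
      ((finite_setOf_int_mul_ne_zero hg (div_ne_zero ha hb)).subset fun l hl h0 ↦ hl ?_)
    rw [div_mul_eq_mul_div] at h0
    simp [hF, h0]
  have hFre (l : ℤ) (hl : l ≠ 0) : (F l).re = (g (a * l / b)).re * w l := by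
    simp [hF, hl]
  have hF0 (l : ℤ) : 0 ≤ (F l).re := by
    by_cases hl : l = 0
    · simp [hF, hl]
    · rw [hFre l hl]; exact mul_nonneg (hre _) (hw l)
  calc ∑ l ∈ Icc 1 n, (g (a * (l : ℝ) / b)).re * w l
      = ∑ l ∈ (Icc 1 n).map Nat.castEmbedding, (F l).re := by
        rw [sum_map]
        refine sum_congr rfl fun l hl ↦ ?_
        have : l ≠ 0 := by have := (mem_Icc.1 hl).1; omega
        rw [Nat.castEmbedding_apply, hFre _ (by exact_mod_cast this)]
        simp
    _ ≤ ∑' l, (F l).re := (Complex.hasSum_re hsum.hasSum).summable.sum_le_tsum _ fun l _ ↦ hF0 l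
    _ = (∑' l, F l).re := (Complex.re_tsum hsum).symm
    _ ≤ _ := Complex.re_le_norm _

/-- Zelditch, Section 6: along the prime-power sequence `N = p^M` the off-diagonal pair
correlation functionals of the quantized quadratic map blow up; in particular they do
not converge to the Poisson limit `f(0)`. -/
theorem prime_power_sequence_not_poisson
    (p : ℕ) (hp : p.Prime) (hodd : Odd p)
    (f : SchwartzMap ℝ ℝ) (hf : HasCompactSupport (FT f))
    (hreal : ∀ ξ : ℝ, (FT f ξ).im = 0 ∧ 0 ≤ (FT f ξ).re)
    (hpos : ∀ ξ ∈ Set.Icc (0:ℝ) 1, 0 < (FT f ξ).re) :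
    Tendsto
      (fun M : ℕ =>
        ‖((1 / ((p : ℝ) ^ M) ^ 2 : ℝ) : ℂ) * ∑' ℓ : ℤ, (if ℓ = 0 then 0 else
          FT f (2 * π * ℓ / (p : ℝ) ^ M) *
            ((‖∑ j ∈ Finset.Icc 1 (p ^ M), Complex.exp (Complex.I *
                ((2 * π * (ℓ : ℝ) * (j : ℝ) ^ 2 / (p : ℝ) ^ M : ℝ) : ℂ))‖ ^ 2 : ℝ) : ℂ))‖)
      atTop atTop ∧
    ¬ Tendsto
      (fun M : ℕ =>
        ((1 / ((p : ℝ) ^ M) ^ 2 : ℝ) : ℂ) * ∑' ℓ : ℤ, (if ℓ = 0 then 0 else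
          FT f (2 * π * ℓ / (p : ℝ) ^ M) *
            ((‖∑ j ∈ Finset.Icc 1 (p ^ M), Complex.exp (Complex.I *
                ((2 * π * (ℓ : ℝ) * (j : ℝ) ^ 2 / (p : ℝ) ^ M : ℝ) : ℂ))‖ ^ 2 : ℝ) : ℂ)))
      atTop (𝓝 ((f 0 : ℂ))) := by
  have hp3 : 3 ≤ p := by
    have := hp.two_le
    obtain ⟨k, rfl⟩ := hodd
    omega
  have hp0 : (0 : ℝ) < p := by exact_mod_cast hp.pos
  obtain ⟨ξ₀, hξ₀, hmin⟩ := isCompact_Icc.exists_isMinOn (Set.nonempty_Icc.2 zero_le_one)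
    (Complex.continuous_re.comp (continuous_FT f)).continuousOn (s := Set.Icc (0 : ℝ) 1)
  set c := (FT f ξ₀).re
  have hc : 0 < c := hpos ξ₀ hξ₀
  refine (and_iff_left_of_imp fun h hlim ↦
    not_tendsto_nhds_of_tendsto_atTop h _ hlim.norm).2 ?_
  rw [← tendsto_add_atTop_iff_nat 2]
  refine tendsto_atTop_mono (f := fun m : ℕ ↦ c / (2 * (p : ℝ) ^ 2) * m) (fun m ↦ ?_)
    (tendsto_natCast_atTop_atTop.const_mul_atTop (by positivity))
  have : NeZero (p ^ (m + 2)) := ⟨pow_ne_zero _ hp.ne_zero⟩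
  have hN : (0 : ℝ) < (p : ℝ) ^ (m + 2) := by positivity
  rw [norm_mul, Complex.norm_real, Real.norm_of_nonneg (by positivity)]
  have hsum : ((m : ℝ) + 1) * (p : ℝ) ^ m ≤
      2 * ∑ l ∈ Finset.Icc 1 (p ^ m), (l.gcd (p ^ (m + 2)) : ℝ) := by
    exact_mod_cast le_sum_gcd_prime_pow hp (show m ≤ m + 2 by omega)
  have hlow : c * (p : ℝ) ^ (m + 2) * ∑ l ∈ Finset.Icc 1 (p ^ m), (l.gcd (p ^ (m + 2)) : ℝ) ≤ _ :=
    le_trans ?_ (sum_re_mul_le_norm_tsum hf (fun ξ ↦ (hreal ξ).2)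
      (mul_pos two_pos pi_pos).ne' hN.ne'
      (fun l ↦ ‖∑ j ∈ Finset.Icc 1 (p ^ (m + 2)), Complex.exp (Complex.I *
        ((2 * π * (l : ℝ) * (j : ℝ) ^ 2 / (p : ℝ) ^ (m + 2) : ℝ) : ℂ))‖ ^ 2)
      (fun l ↦ by positivity) (p ^ m))
  · calc c / (2 * (p : ℝ) ^ 2) * m
        ≤ c / (2 * (p : ℝ) ^ 2) * (m + 1) := by gcongr; linarith
      _ = 1 / ((p : ℝ) ^ (m + 2)) ^ 2 *
          (c * (p : ℝ) ^ (m + 2) * (((m : ℝ) + 1) * (p : ℝ) ^ m / 2)) := by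
        field_simp
        ring
      _ ≤ 1 / ((p : ℝ) ^ (m + 2)) ^ 2 * (c * (p : ℝ) ^ (m + 2) *
          ∑ l ∈ Finset.Icc 1 (p ^ m), (l.gcd (p ^ (m + 2)) : ℝ)) := by
        gcongr
        linarith
      _ ≤ _ := by gcongr
  · rw [Finset.mul_sum]
    refine Finset.sum_le_sum fun l hl ↦ ?_
    rw [mul_assoc]
    have hξ : 2 * π * (l : ℝ) / (p : ℝ) ^ (m + 2) ∈ Set.Icc (0 : ℝ) 1 := by
      refine ⟨by positivity, (div_le_one hN).2 ?_⟩
      have hl' : (l : ℝ) ≤ (p : ℝ) ^ m := by exact_mod_cast (Finset.mem_Icc.1 hl).2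
      have h9 : (9 : ℝ) ≤ (p : ℝ) ^ 2 := by exact_mod_cast Nat.pow_le_pow_left hp3 2
      calc 2 * π * (l : ℝ) ≤ 9 * (p : ℝ) ^ m := by
            gcongr
            linarith [pi_lt_four]
        _ ≤ (p : ℝ) ^ 2 * (p : ℝ) ^ m := by gcongr
        _ = _ := by ring
    have hG := mul_gcd_le_normSq_sum_exp (N := p ^ (m + 2)) hodd.pow l
    push_cast at hG ⊢
    exact mul_le_mul (hmin hξ) hG (by positivity) (hreal _).2
end

section
/- Let φ : [0,1] → ℝ be C¹ with |φ'(x)| ≥ C₁ > 0 for all x, let A ≥ 0, and for each N ∈ ℕ let ε_N : [0,1] → ℝ be C¹ with sup_{x∈[0,1]} (|ε_N(x)| + |ε_N'(x)|) ≤ A/N; set Φ_N = φ + ε_N. Let f be a Schwartz function with compactly supported Fourier transform f̂, supported in [−K, K], and let a < b. Then there is a constant C (depending on φ, A, a, b, f) such that for all N ≥ 2, | (1/(b−a)) ∫_a^b (1/N²) Σ_{ℓ∈ℤ, ℓ≠0} f̂(2πℓ/N) |Σ_{j=1}^N exp(i t ℓ N Φ_N(j/N))|² dt − (1/N) Σ_{ℓ∈ℤ,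 ℓ≠0} f̂(2πℓ/N) | ≤ C (log N)/N. -/
open MeasureTheory Filter Topology Real

theorem inv_sub_mul_inv_sub {ι : Type*} [DecidableEq ι] {x : ι → ℝ}
    (hx : Function.Injective x) (r s t : ι) :
    (x r - x s)⁻¹ * (x s - x t)⁻¹ =
      (x r - x t)⁻¹ * ((x r - x s)⁻¹ + (x s - x t)⁻¹)
        - ((if s = r then 1 else 0) + (if s = t then 1 else 0)) * ((x r - x t)⁻¹) ^ 2
        - (if r = t then 1 else 0) * ((x r - x s)⁻¹) ^ 2 := by
  by_cases hsr : s = r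
  · subst hsr
    by_cases hst : s = t
    · subst hst; simp
    · simp [hst, -inv_pow]; ring
  · by_cases hst : s = t
    · subst hst
      simp [hsr, Ne.symm hsr, -inv_pow]; ring
    · have h1 : x r - x s ≠ 0 := sub_ne_zero.2 fun h => hsr (hx h).symm
      have h2 : x s - x t ≠ 0 := sub_ne_zero.2 fun h => hst (hx h)
      by_cases hrt : r = t
      · subst hrt
        have h3 : (x s - x r)⁻¹ = -(x r - x s)⁻¹ := by rw [← neg_sub, inv_neg]
        simp [hst, h3, -inv_pow]; ring
      · have h3 : x r - x t ≠ 0 := sub_ne_zero.2 fun h => hrt (hx h)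
        simp only [hsr, hst, hrt, if_false]
        field_simp
        ring

theorem sum_inv_sub_mul_inv_sub {ι : Type*} [Fintype ι] [DecidableEq ι] {x : ι → ℝ}
    (hx : Function.Injective x) (r t : ι) :
    ∑ s, (x r - x s)⁻¹ * (x s - x t)⁻¹ =
      (x r - x t)⁻¹ * (∑ s, (x r - x s)⁻¹ - ∑ s, (x t - x s)⁻¹)
        - 2 * ((x r - x t)⁻¹) ^ 2
        - (if r = t then 1 else 0) * ∑ s, ((x r - x s)⁻¹) ^ 2 := by
  rw [Finset.sum_congr rfl fun s _ => inv_sub_mul_inv_sub hx r s t]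
  have h (s : ι) : (x t - x s)⁻¹ = -(x s - x t)⁻¹ := by rw [← neg_sub, inv_neg]
  simp only [h, Finset.sum_sub_distrib, ← Finset.mul_sum, ← Finset.sum_mul,
    Finset.sum_add_distrib, Finset.sum_neg_distrib]
  simp only [Finset.sum_ite_eq', Finset.mem_univ, if_true]
  ring

/-- Bound for the eigenvalues of the generalized Hilbert matrix `1 / (x r - x s)`. -/
theorem sq_le_of_hilbert_eigenvector {ι : Type*} [Fintype ι] [DecidableEq ι] {x : ι → ℝ}
    (hx : Function.Injective x) {E : ℝ} (hE : ∀ r, ∑ s, ((x r - x s)⁻¹) ^ 2 ≤ E)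
    {v : ι → ℂ} (hv : v ≠ 0) {μ : ℝ}
    (h : ∀ r, ∑ s, ((x r - x s)⁻¹ : ℝ) * v s = Complex.I * μ * v r) :
    μ ^ 2 ≤ 3 * E := by
  set a : ι → ι → ℝ := fun r s => (x r - x s)⁻¹ with ha
  have hanti (r s : ι) : a s r = -a r s := by simp only [ha]; rw [← neg_sub, inv_neg]
  have hsum : ∑ r, ∑ t, starRingEnd ℂ (v r) * ((∑ s, a r s * a s t : ℝ) : ℂ) * v t =
      -(μ : ℂ) ^ 2 * ∑ r, starRingEnd ℂ (v r) * v r := by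
    have h1 (r : ι) : ∑ t, starRingEnd ℂ (v r) * ((∑ s, a r s * a s t : ℝ) : ℂ) * v t =
        starRingEnd ℂ (v r) * ∑ s, (a r s : ℂ) * ∑ t, (a s t : ℂ) * v t := by
      simp only [Finset.mul_sum, Complex.ofReal_sum, Complex.ofReal_mul, Finset.sum_mul]
      rw [Finset.sum_comm]
      exact Finset.sum_congr rfl fun _ _ => Finset.sum_congr rfl fun _ _ => by ring
    have h2 (r : ι) : ∑ s, (a r s : ℂ) * ∑ t, (a s t : ℂ) * v t = -(μ : ℂ) ^ 2 * v r := by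
      rw [Finset.sum_congr rfl fun s _ => by rw [h s]]
      have : ∑ s, (a r s : ℂ) * (Complex.I * μ * v s) =
          Complex.I * μ * ∑ s, (a r s : ℂ) * v s := by
        rw [Finset.mul_sum]
        exact Finset.sum_congr rfl fun _ _ => by ring
      rw [this, h r]
      linear_combination (μ : ℂ) ^ 2 * v r * Complex.I_sq
    rw [Finset.mul_sum]
    exact Finset.sum_congr rfl fun r _ => by rw [h1, h2]; ring
  have hcomm (d : ι → ℝ) :
      ∑ r, ∑ t, starRingEnd ℂ (v r) * ((a r t * (d r - d t) : ℝ) : ℂ) * v t = 0 := by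
    have h1 : ∑ r, ∑ t, starRingEnd ℂ (v r) * ((a r t * d r : ℝ) : ℂ) * v t =
        ∑ r, Complex.I * μ * d r * (starRingEnd ℂ (v r) * v r) := by
      refine Finset.sum_congr rfl fun r _ => ?_
      calc _ = d r * starRingEnd ℂ (v r) * ∑ t, (a r t : ℂ) * v t := by
            rw [Finset.mul_sum]
            exact Finset.sum_congr rfl fun _ _ => by push_cast; ring
        _ = _ := by rw [h r]; ring
    have h2 : ∑ r, ∑ t, starRingEnd ℂ (v r) * ((a r t * d t : ℝ) : ℂ) * v t =
        ∑ r, Complex.I * μ * d r * (starRingEnd ℂ (v r) * v r) := by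
      rw [Finset.sum_comm]
      refine Finset.sum_congr rfl fun t _ => ?_
      have h3 := congrArg (starRingEnd ℂ) (h t)
      simp only [map_sum, map_mul, Complex.conj_ofReal, Complex.conj_I] at h3
      calc _ = -(d t * v t) * ∑ r, (a t r : ℂ) * starRingEnd ℂ (v r) := by
            rw [Finset.mul_sum]
            exact Finset.sum_congr rfl fun r _ => by rw [hanti t r]; push_cast; ring
        _ = _ := by rw [h3]; ring
    simp only [mul_sub, sub_mul, Complex.ofReal_sub, Finset.sum_sub_distrib]
    rw [h1, h2, sub_self]
  have hkey : (μ : ℂ) ^ 2 * ∑ r, starRingEnd ℂ (v r) * v r =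
      2 * ∑ r, ∑ t, starRingEnd ℂ (v r) * ((a r t ^ 2 : ℝ) : ℂ) * v t
        + ∑ r, starRingEnd ℂ (v r) * ((∑ s, a r s ^ 2 : ℝ) : ℂ) * v r := by
    have h1 : ∑ r, ∑ t, starRingEnd ℂ (v r) * ((∑ s, a r s * a s t : ℝ) : ℂ) * v t =
        ∑ r, ∑ t, starRingEnd ℂ (v r) * ((a r t * (∑ s, a r s - ∑ s, a t s) : ℝ) : ℂ) * v t
        - 2 * ∑ r, ∑ t, starRingEnd ℂ (v r) * ((a r t ^ 2 : ℝ) : ℂ) * v t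
        - ∑ r, starRingEnd ℂ (v r) * ((∑ s, a r s ^ 2 : ℝ) : ℂ) * v r := by
      have h2 (r t : ι) : ∑ s, a r s * a s t = _ := sum_inv_sub_mul_inv_sub hx r t
      simp only [h2, Finset.mul_sum _ _ (2 : ℂ)]
      rw [← Finset.sum_sub_distrib, ← Finset.sum_sub_distrib]
      refine Finset.sum_congr rfl fun r _ => ?_
      have h4 : starRingEnd ℂ (v r) * ((∑ s, a r s ^ 2 : ℝ) : ℂ) * v r =
          ∑ t, if r = t then starRingEnd ℂ (v r) * ((∑ s, a r s ^ 2 : ℝ) : ℂ) * v t else 0 := by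
        simp
      rw [h4, ← Finset.sum_sub_distrib, ← Finset.sum_sub_distrib]
      refine Finset.sum_congr rfl fun t _ => ?_
      split_ifs <;> simp only [ha] <;> push_cast <;> ring
    rw [hcomm, hsum] at h1
    linear_combination -h1
  have hnorm : ∑ r, starRingEnd ℂ (v r) * v r = ((∑ r, ‖v r‖ ^ 2 : ℝ) : ℂ) := by
    simp [Complex.conj_mul']
  have hpos : 0 < ∑ r, ‖v r‖ ^ 2 := by
    obtain ⟨i, hi⟩ := Function.ne_iff.1 hv
    exact Finset.sum_pos' (fun _ _ => by positivity)
      ⟨i, Finset.mem_univ _, by have := norm_pos_iff.2 hi; positivity⟩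
  have hdiag : ∑ r, (∑ s, a r s ^ 2) * ‖v r‖ ^ 2 ≤ E * ∑ r, ‖v r‖ ^ 2 := by
    rw [Finset.mul_sum]
    exact Finset.sum_le_sum fun r _ => mul_le_mul_of_nonneg_right (hE r) (by positivity)
  have hoff : ∑ r, ∑ t, ‖v r‖ * a r t ^ 2 * ‖v t‖ ≤ E * ∑ r, ‖v r‖ ^ 2 := by
    have h1 : ∑ r, ∑ t, ‖v r‖ * a r t ^ 2 * ‖v t‖ ≤
        ∑ r, ∑ t, (a r t ^ 2 * ‖v r‖ ^ 2 / 2 + a r t ^ 2 * ‖v t‖ ^ 2 / 2) := by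
      refine Finset.sum_le_sum fun r _ => Finset.sum_le_sum fun t _ => ?_
      nlinarith [mul_nonneg (sq_nonneg (a r t)) (sq_nonneg (‖v r‖ - ‖v t‖))]
    have h2 : ∑ r, ∑ t, a r t ^ 2 * ‖v r‖ ^ 2 / 2 = (∑ r, (∑ s, a r s ^ 2) * ‖v r‖ ^ 2) / 2 := by
      simp only [Finset.sum_mul, Finset.sum_div]
    have h3 : ∑ r, ∑ t, a r t ^ 2 * ‖v t‖ ^ 2 / 2 = (∑ r, (∑ s, a r s ^ 2) * ‖v r‖ ^ 2) / 2 := by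
      rw [Finset.sum_comm, ← h2]
      refine Finset.sum_congr rfl fun r _ => Finset.sum_congr rfl fun t _ => ?_
      rw [hanti r t]; ring
    simp only [Finset.sum_add_distrib] at h1
    linarith
  have hfin : μ ^ 2 * ∑ r, ‖v r‖ ^ 2 ≤
      2 * ∑ r, ∑ t, ‖v r‖ * a r t ^ 2 * ‖v t‖ + ∑ r, (∑ s, a r s ^ 2) * ‖v r‖ ^ 2 := by
    have h0 : 0 ≤ μ ^ 2 * ∑ r, ‖v r‖ ^ 2 := by positivity
    rw [hnorm, ← Complex.ofReal_pow, ← Complex.ofReal_mul] at hkey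
    have h1 := congrArg norm hkey
    rw [Complex.norm_real, Real.norm_of_nonneg h0] at h1
    rw [h1]
    refine (norm_add_le _ _).trans (add_le_add ?_ ?_)
    · rw [norm_mul, Complex.norm_ofNat]
      refine mul_le_mul_of_nonneg_left ?_ zero_le_two
      refine (norm_sum_le _ _).trans (Finset.sum_le_sum fun r _ => ?_)
      refine (norm_sum_le _ _).trans (Finset.sum_le_sum fun t _ => ?_)
      simp
    · refine (norm_sum_le _ _).trans (Finset.sum_le_sum fun r _ => ?_)
      rw [norm_mul, norm_mul, Complex.norm_real, RCLike.norm_conj,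
        Real.norm_of_nonneg (by positivity)]
      exact le_of_eq (by ring)
  nlinarith

open scoped ComplexOrder in
/-- Hilbert's inequality for a generalized Hilbert matrix. -/
theorem norm_sum_hilbert_le {ι : Type*} [Fintype ι] [DecidableEq ι] {x : ι → ℝ}
    (hx : Function.Injective x) {M : ℝ} (hM : 0 ≤ M)
    (hE : ∀ r, 3 * ∑ s, ((x r - x s)⁻¹) ^ 2 ≤ M ^ 2) (u : ι → ℂ) :
    ‖∑ r, ∑ s, starRingEnd ℂ (u r) * ((x r - x s)⁻¹ : ℝ) * u s‖ ≤ M * ∑ r, ‖u r‖ ^ 2 := by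
  set B : Matrix ι ι ℂ := Matrix.of fun r s => Complex.I * ((x r - x s)⁻¹ : ℝ) with hB
  have hBH : B.IsHermitian := by
    ext r s
    simp only [hB, Matrix.conjTranspose_apply, Matrix.of_apply, star_mul']
    rw [← neg_sub (x r) (x s), inv_neg]
    simp
  have heig {v : ι → ℂ} (hv : v ≠ 0) {μ : ℝ} (h : B.mulVec v = (μ : ℂ) • v) : |μ| ≤ M := by
    refine abs_le_of_sq_le_sq ?_ hM
    have h' := sq_le_of_hilbert_eigenvector (E := M ^ 2 / 3) hx
      (fun r => by linarith [hE r]) hv (μ := -μ) fun r => by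
        have h1 := congrFun h r
        simp only [hB, Matrix.mulVec, dotProduct, Matrix.of_apply, Pi.smul_apply,
          smul_eq_mul, mul_assoc, ← Finset.mul_sum] at h1
        push_cast at h1 ⊢
        linear_combination -Complex.I * h1 + (∑ s, ((x r : ℂ) - x s)⁻¹ * v s) * Complex.I_sq
    nlinarith
  have hpsd (σ : ℝ) (hσ : |σ| = 1) : ((M : ℂ) • (1 : Matrix ι ι ℂ) - (σ : ℂ) • B).PosSemidef := by
    have hσ2 : (σ : ℂ) * σ = 1 := by
      rw [← Complex.ofReal_mul, ← abs_mul_abs_self, hσ]; simp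
    have hH : ((M : ℂ) • (1 : Matrix ι ι ℂ) - (σ : ℂ) • B).IsHermitian := by
      rw [Matrix.IsHermitian, Matrix.conjTranspose_sub, Matrix.conjTranspose_smul,
        Matrix.conjTranspose_smul, hBH.eq]
      simp
    rw [hH.posSemidef_iff_eigenvalues_nonneg]
    intro i
    have h1 := hH.mulVec_eigenvectorBasis i
    set v := (hH.eigenvectorBasis i).ofLp
    have hv : v ≠ 0 := fun h0 =>
      hH.eigenvectorBasis.toBasis.ne_zero i (by simpa using WithLp.ofLp_injective 2 h0)
    have h2 := heig hv (μ := σ * (M - hH.eigenvalues i)) <| by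
      ext r
      have h3 := congrFun h1 r
      simp only [Matrix.sub_mulVec, Matrix.smul_mulVec, Matrix.one_mulVec, Pi.sub_apply,
        Pi.smul_apply, smul_eq_mul, Complex.real_smul] at h3 ⊢
      push_cast
      linear_combination -(σ : ℂ) * h3 - (B.mulVec v r) * hσ2
    rw [abs_mul, hσ, one_mul] at h2
    show 0 ≤ hH.eigenvalues i
    linarith [(abs_le.1 h2).2]
  set Q := ∑ r, ∑ s, starRingEnd ℂ (u r) * ((x r - x s)⁻¹ : ℝ) * u s with hQ
  have hquad (σ : ℝ) (hσ : |σ| = 1) : σ * (Complex.I * Q).re ≤ M * ∑ r, ‖u r‖ ^ 2 := by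
    have h1 := (hpsd σ hσ).re_dotProduct_nonneg u
    have h2 : dotProduct (star u) (((M : ℂ) • (1 : Matrix ι ι ℂ) - (σ : ℂ) • B).mulVec u) =
        ((M * ∑ r, ‖u r‖ ^ 2 : ℝ) : ℂ) - σ * (Complex.I * Q) := by
      rw [Matrix.sub_mulVec, Matrix.smul_mulVec, Matrix.smul_mulVec, Matrix.one_mulVec,
        dotProduct_sub, dotProduct_smul, dotProduct_smul]
      congr 2
      · simp [dotProduct, Complex.conj_mul']
      · simp only [hQ, hB, dotProduct, Matrix.mulVec, Finset.mul_sum, Matrix.of_apply,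
          Pi.star_apply]
        refine Finset.sum_congr rfl fun r _ => Finset.sum_congr rfl fun s _ => ?_
        simp only [starRingEnd_apply]
        ring
    rw [h2, RCLike.re_to_complex, Complex.sub_re, Complex.ofReal_re, Complex.re_ofReal_mul] at h1
    linarith
  have him : (Complex.I * Q).im = 0 := by
    have hc : starRingEnd ℂ Q = -Q := by
      simp only [hQ, map_sum, map_mul, Complex.conj_conj, Complex.conj_ofReal]
      rw [Finset.sum_comm, ← Finset.sum_neg_distrib]
      refine Finset.sum_congr rfl fun r _ => ?_
      rw [← Finset.sum_neg_distrib]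
      refine Finset.sum_congr rfl fun s _ => ?_
      rw [← neg_sub (x r) (x s), inv_neg]
      push_cast; ring
    have := congrArg Complex.re hc
    simp at this ⊢
    linarith
  have hn : ‖Q‖ = |(Complex.I * Q).re| := by
    rw [Complex.abs_re_eq_norm.2 him, norm_mul, Complex.norm_I, one_mul]
  rw [hn]
  exact abs_le.2 ⟨by linarith [hquad (-1) (by simp)], by linarith [hquad 1 (by simp)]⟩

theorem sum_inv_sq_natCast_sub_le (N : ℕ) (r : ℕ) :
    ∑ s ∈ Finset.range N, (((r : ℝ) - s)⁻¹) ^ 2 ≤ 4 := by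
  have hhead (n : ℕ) : ∑ k ∈ Finset.range n, (((k : ℝ))⁻¹) ^ 2 ≤ 2 := by
    have h := sum_Ioo_inv_sq_le (α := ℝ) 0 n
    have h2 : ∑ k ∈ Finset.range n, (((k : ℝ))⁻¹) ^ 2 = ∑ k ∈ Finset.Ioo 0 n, ((k : ℝ) ^ 2)⁻¹ := by
      symm
      simp only [inv_pow]
      refine Finset.sum_subset (fun k hk => ?_) fun k hk hk' => ?_
      · simp at hk ⊢; omega
      · have : k = 0 := by simp at hk hk'; omega
        simp [this]
    rw [h2]
    simpa using h
  have hmono : ∑ s ∈ Finset.range N, (((r : ℝ) - s)⁻¹) ^ 2 ≤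
      ∑ s ∈ Finset.range (r + 1 + N), (((r : ℝ) - s)⁻¹) ^ 2 :=
    Finset.sum_le_sum_of_subset_of_nonneg (by simp) fun _ _ _ => by positivity
  refine hmono.trans ?_
  rw [Finset.sum_range_add, ← Finset.sum_range_reflect]
  have h1 : ∑ j ∈ Finset.range (r + 1), (((r : ℝ) - ((r + 1 - 1 - j : ℕ) : ℝ))⁻¹) ^ 2 ≤ 2 := by
    refine le_trans (le_of_eq (Finset.sum_congr rfl fun j hj => ?_)) (hhead (r + 1))
    have hj' : j ≤ r := by simp at hj; omega
    rw [Nat.add_sub_cancel, Nat.cast_sub hj', sub_sub_cancel]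
  have h2 : ∑ j ∈ Finset.range N, (((r : ℝ) - ((r + 1 + j : ℕ) : ℝ))⁻¹) ^ 2 ≤ 2 := by
    refine le_trans (le_of_eq ?_) (hhead (N + 1))
    rw [Finset.sum_range_succ' _ N]
    simp only [Nat.cast_zero, inv_zero, ne_eq, OfNat.ofNat_ne_zero, not_false_eq_true, zero_pow,
      add_zero]
    refine Finset.sum_congr rfl fun j _ => ?_
    rw [show (r : ℝ) - ((r + 1 + j : ℕ) : ℝ) = -((j + 1 : ℕ) : ℝ) by push_cast; ring, inv_neg,
      neg_sq]
  linarith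

theorem injective_of_separated {N : ℕ} {x : Fin N → ℝ} {δ : ℝ} (hδ : 0 < δ)
    (hx : ∀ r s : Fin N, δ * |(r : ℝ) - s| ≤ |x r - x s|) : Function.Injective x := fun r s h => by
  have h1 := hx r s
  rw [h, sub_self, abs_zero] at h1
  have h2 : |(r : ℝ) - s| ≤ 0 := nonpos_of_mul_nonpos_right h1 hδ
  have h3 := sub_eq_zero.1 (abs_nonpos_iff.1 h2)
  exact Fin.ext (by exact_mod_cast h3)

/-- Hilbert's inequality for frequencies separated by `δ`. -/
theorem norm_sum_hilbert_le_of_separated {N : ℕ} {x : Fin N → ℝ} {δ : ℝ} (hδ : 0 < δ)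
    (hx : ∀ r s : Fin N, δ * |(r : ℝ) - s| ≤ |x r - x s|) (u : Fin N → ℂ) :
    ‖∑ r, ∑ s, starRingEnd ℂ (u r) * ((x r - x s)⁻¹ : ℝ) * u s‖ ≤ 4 / δ * ∑ r, ‖u r‖ ^ 2 := by
  refine norm_sum_hilbert_le (injective_of_separated hδ hx) (by positivity) (fun r => ?_) u
  have h1 : ∑ s, ((x r - x s)⁻¹) ^ 2 ≤ ∑ s : Fin N, (δ⁻¹) ^ 2 * (((r : ℝ) - (s : ℕ))⁻¹) ^ 2 := by
    refine Finset.sum_le_sum fun s _ => ?_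
    rcases eq_or_ne r s with rfl | hrs
    · simp
    · have h0 : (r : ℝ) - s ≠ 0 := sub_ne_zero.2 fun h => hrs (Fin.ext (by exact_mod_cast h))
      rw [← mul_pow, ← mul_inv, ← sq_abs, ← sq_abs ((δ * _)⁻¹), abs_inv, abs_inv, abs_mul,
        abs_of_pos hδ]
      have := abs_pos.2 h0
      gcongr
      exact hx r s
  rw [← Finset.mul_sum, Fin.sum_univ_eq_sum_range (fun s => (((r : ℝ) - (s : ℕ))⁻¹) ^ 2)] at h1
  have h2 := sum_inv_sq_natCast_sub_le N r
  have h3 : (δ⁻¹) ^ 2 * ∑ s ∈ Finset.range N, (((r : ℝ) - s)⁻¹) ^ 2 ≤ (δ⁻¹) ^ 2 * 4 := by gcongr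
  rw [div_eq_mul_inv, mul_pow]
  nlinarith [sq_nonneg δ⁻¹]

/-- Mean value of the square modulus of an exponential sum with separated frequencies. -/
theorem abs_integral_norm_sq_exp_sum_sub_le {N : ℕ} {x : Fin N → ℝ} {δ : ℝ} (hδ : 0 < δ)
    (hx : ∀ r s : Fin N, δ * |(r : ℝ) - s| ≤ |x r - x s|) (a b : ℝ) :
    |(∫ t in a..b, ‖∑ j, Complex.exp (Complex.I * ((t * x j : ℝ) : ℂ))‖ ^ 2) - (b - a) * N| ≤
      8 * N / δ := by
  set e : ℝ → Fin N → ℂ := fun t j => Complex.exp (Complex.I * ((t * x j : ℝ) : ℂ)) with he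
  set H : ℝ → ℂ := fun t => ∑ r, ∑ s, starRingEnd ℂ (e t r) * ((x r - x s)⁻¹ : ℝ) * e t s with hH
  have hen (t : ℝ) (j : Fin N) : ‖e t j‖ = 1 := by
    simp only [he]; rw [mul_comm]; exact Complex.norm_exp_ofReal_mul_I _
  have hHn (t : ℝ) : ‖H t‖ ≤ 4 / δ * N := by
    simpa only [hen, one_pow, Finset.sum_const, Finset.card_univ, Fintype.card_fin, nsmul_eq_mul,
      mul_one] using norm_sum_hilbert_le_of_separated hδ hx (e t)
  have hconj (t : ℝ) (r : Fin N) :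
      starRingEnd ℂ (e t r) = Complex.exp (-(Complex.I * ((t * x r : ℝ) : ℂ))) := by
    simp only [he, ← Complex.exp_conj, map_mul, Complex.conj_I, Complex.conj_ofReal, neg_mul]
  have hpair (t : ℝ) (r s : Fin N) :
      starRingEnd ℂ (e t r) * e t s = Complex.exp (Complex.I * (x s - x r) * t) := by
    rw [hconj, ← Complex.exp_add]
    congr 1
    push_cast; ring
  have hderiv (t : ℝ) : HasDerivAt (fun t : ℝ => (N : ℂ) * t + Complex.I * H t)
      ((‖∑ j, e t j‖ ^ 2 : ℝ) : ℂ) t := by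
    have hterm (r s : Fin N) : HasDerivAt
        (fun t : ℝ => starRingEnd ℂ (e t r) * ((x r - x s)⁻¹ : ℝ) * e t s)
        (-Complex.I * (starRingEnd ℂ (e t r) * e t s - if r = s then 1 else 0)) t := by
      have h1 : HasDerivAt (fun t : ℝ => Complex.exp (Complex.I * (x s - x r) * t))
          (Complex.exp (Complex.I * (x s - x r) * t) * (Complex.I * (x s - x r) * 1)) t :=
        ((Complex.ofRealCLM.hasDerivAt (x := t)).const_mul _).cexp
      have h2 := h1.const_mul (((x r - x s)⁻¹ : ℝ) : ℂ)
      have h4 : (fun t : ℝ => starRingEnd ℂ (e t r) * ((x r - x s)⁻¹ : ℝ) * e t s) =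
          fun t : ℝ => (((x r - x s)⁻¹ : ℝ) : ℂ) *
            Complex.exp (Complex.I * (x s - x r) * t) := by
        funext t
        rw [← hpair]; ring
      rw [h4]
      refine h2.congr_deriv ?_
      · rw [← hpair]
        rcases eq_or_ne r s with rfl | hrs
        · simp [Complex.conj_mul', hen]
        · have h3 : (x r : ℂ) - x s ≠ 0 := by
            exact_mod_cast sub_ne_zero.2 ((injective_of_separated hδ hx).ne hrs)
          simp only [hrs, if_false]
          push_cast
          field_simp
          ring
    have hsum : HasDerivAt H
        (∑ r, ∑ s, -Complex.I * (starRingEnd ℂ (e t r) * e t s - if r = s then 1 else 0)) t :=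
      HasDerivAt.fun_sum fun r _ => HasDerivAt.fun_sum fun s _ => hterm r s
    have h4 := ((Complex.ofRealCLM.hasDerivAt (x := t)).const_mul (N : ℂ)).add
      (hsum.const_mul Complex.I)
    refine h4.congr_deriv ?_
    have h5 : ((‖∑ j, e t j‖ ^ 2 : ℝ) : ℂ) = ∑ r, ∑ s, starRingEnd ℂ (e t r) * e t s := by
      push_cast
      rw [← Complex.conj_mul', map_sum, Finset.sum_mul_sum]
    have h6 : ∑ r, ∑ s, -Complex.I * (starRingEnd ℂ (e t r) * e t s - if r = s then 1 else 0) =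
        -Complex.I * (∑ r, ∑ s, starRingEnd ℂ (e t r) * e t s - N) := by
      simp only [mul_sub, Finset.mul_sum, Finset.sum_sub_distrib, mul_ite, mul_one, mul_zero,
        Finset.sum_ite_eq, Finset.mem_univ, if_true, Finset.sum_const, Finset.card_univ,
        Fintype.card_fin, nsmul_eq_mul]
      ring
    rw [h5, h6, Complex.ofRealCLM_apply, Complex.ofReal_one]
    linear_combination (N - ∑ r, ∑ s, starRingEnd ℂ (e t r) * e t s) * Complex.I_sq
  have hcont : Continuous fun t : ℝ => ‖∑ j, e t j‖ ^ 2 := by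
    simp only [he]; fun_prop
  have hint : ∫ t in a..b, ((‖∑ j, e t j‖ ^ 2 : ℝ) : ℂ) = _ :=
    intervalIntegral.integral_eq_sub_of_hasDerivAt (fun t _ => hderiv t)
      ((Complex.continuous_ofReal.comp hcont).intervalIntegrable a b)
  rw [intervalIntegral.integral_ofReal] at hint
  have hfin : (((∫ t in a..b, ‖∑ j, e t j‖ ^ 2) - (b - a) * N : ℝ) : ℂ) =
      Complex.I * (H b - H a) := by
    push_cast at hint ⊢
    rw [hint]; ring
  rw [← Real.norm_eq_abs, ← Complex.norm_real, hfin, norm_mul, Complex.norm_I, one_mul]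
  refine (norm_sub_le _ _).trans ((add_le_add (hHn b) (hHn a)).trans (le_of_eq ?_))
  ring

theorem mul_abs_sub_le_of_derivWithin {g : ℝ → ℝ} (hg : DifferentiableOn ℝ g (Set.Icc 0 1)) {c : ℝ}
    (hc : ∀ y ∈ Set.Icc (0 : ℝ) 1, c ≤ |derivWithin g (Set.Icc 0 1) y|)
    {y z : ℝ} (hy : y ∈ Set.Icc (0 : ℝ) 1) (hz : z ∈ Set.Icc (0 : ℝ) 1) :
    c * |y - z| ≤ |g y - g z| := by
  wlog hyz : y < z generalizing y z
  · rcases (not_lt.1 hyz).eq_or_lt with rfl | h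
    · simp
    · rw [abs_sub_comm y, abs_sub_comm (g y)]
      exact this hz hy h
  have hsub : Set.Icc y z ⊆ Set.Icc 0 1 := Set.Icc_subset_Icc hy.1 hz.2
  obtain ⟨w, hw, hw'⟩ := exists_deriv_eq_slope g hyz (hg.continuousOn.mono hsub)
    (hg.mono (Set.Ioo_subset_Icc_self.trans hsub))
  have hnhds : Set.Icc (0 : ℝ) 1 ∈ 𝓝 w :=
    Icc_mem_nhds (hy.1.trans_lt hw.1) (hw.2.trans_le hz.2)
  have h1 := hc w (hsub (Set.Ioo_subset_Icc_self hw))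
  rw [derivWithin_of_mem_nhds hnhds, hw', abs_div, le_div_iff₀ (abs_pos.2 (by linarith))] at h1
  rwa [abs_sub_comm y, abs_sub_comm (g y)]

theorem norm_FT_le (f : ℝ → ℝ) (ξ : ℝ) : ‖FT f ξ‖ ≤ ∫ x, |f x| := by
  refine (norm_integral_le_integral_norm _).trans (le_of_eq (integral_congr_ae (ae_of_all _ ?_)))
  intro x
  have h : -(Complex.I * x * ξ) = ((-(x * ξ) : ℝ) : ℂ) * Complex.I := by push_cast; ring
  simp only [h, norm_mul, Complex.norm_exp_ofReal_mul_I, Complex.norm_real, Real.norm_eq_abs,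
    mul_one]

theorem FT_eq_zero_of_natCast_lt {f : ℝ → ℝ} {K : ℝ} (hf : Function.support (FT f) ⊆ Set.Icc (-K) K)
    {N : ℕ} (hN : 1 ≤ N) {ℓ : ℤ} (hℓ : ℓ ∉ Finset.Icc (-(⌈|K|⌉₊ * N : ℕ) : ℤ) (⌈|K|⌉₊ * N : ℕ)) :
    FT f (2 * π * ℓ / N) = 0 := by
  by_contra h
  have h1 : |2 * π * ℓ / N| ≤ K := abs_le.2 (hf h)
  have hN' : (0 : ℝ) < N := by exact_mod_cast hN
  rw [abs_div, abs_mul, abs_of_pos Real.two_pi_pos, Nat.abs_cast, div_le_iff₀ hN'] at h1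
  have h2 : |(ℓ : ℝ)| ≤ (⌈|K|⌉₊ * N : ℕ) := by
    push_cast
    have h3 : K ≤ ⌈|K|⌉₊ := (le_abs_self K).trans (Nat.le_ceil _)
    nlinarith [Real.pi_gt_three, abs_nonneg (ℓ : ℝ)]
  apply hℓ
  rw [Finset.mem_Icc, ← abs_le]
  exact_mod_cast h2

theorem sum_inv_abs_Icc_neg (L : ℕ) :
    ∑ ℓ ∈ Finset.Icc (-(L : ℤ)) L, |(ℓ : ℝ)|⁻¹ ≤ 2 * (1 + Real.log L) := by
  have h : ∑ ℓ ∈ Finset.Icc (-(L : ℤ)) L, |(ℓ : ℝ)|⁻¹ = 2 * (harmonic L : ℝ) := by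
    induction L with
    | zero => simp
    | succ n ih =>
      have hI : Finset.Icc (-((n + 1 : ℕ) : ℤ)) ((n + 1 : ℕ) : ℤ) =
          insert (-((n + 1 : ℕ) : ℤ)) (insert ((n + 1 : ℕ) : ℤ) (Finset.Icc (-(n : ℤ)) n)) := by
        ext k; simp only [Finset.mem_Icc, Finset.mem_insert]; omega
      rw [hI, Finset.sum_insert (by simp; omega), Finset.sum_insert (by simp), ih, harmonic_succ]
      push_cast
      rw [abs_neg, abs_of_pos (by positivity : (0 : ℝ) < n + 1)]
      ring
  rw [h]
  linarith [harmonic_le_one_add_log L]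

theorem sum_Icc_one_eq_sum_fin {M : Type*} [AddCommMonoid M] (F : ℕ → M) (N : ℕ) :
    ∑ j ∈ Finset.Icc 1 N, F j = ∑ j : Fin N, F (j + 1) := by
  rw [Fin.sum_univ_eq_sum_range (fun j => F (j + 1)), Finset.range_eq_Ico,
    Finset.sum_Ico_add' F 0 N 1]
  rfl

theorem exists_forall_le_mul_of_eventually {q g : ℕ → ℝ} {n₀ : ℕ} (hg : ∀ n, n₀ ≤ n → 0 < g n)
    (hq : ∀ n, 0 ≤ q n) {D : ℝ} {n₁ : ℕ} (h : ∀ n, n₀ ≤ n → n₁ ≤ n → q n ≤ D * g n) :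
    ∃ C, ∀ n, n₀ ≤ n → q n ≤ C * g n := by
  refine ⟨|D| + ∑ n ∈ Finset.Ico n₀ n₁, q n / g n, fun n hn => ?_⟩
  have hnn : ∀ m ∈ Finset.Ico n₀ n₁, 0 ≤ q m / g m := fun m hm =>
    div_nonneg (hq m) (hg m (Finset.mem_Ico.1 hm).1).le
  rw [← div_le_iff₀ (hg n hn)]
  rcases lt_or_ge n n₁ with hlt | hge
  · have h1 := Finset.single_le_sum hnn (Finset.mem_Ico.2 ⟨hn, hlt⟩)
    linarith [abs_nonneg D]
  · have h1 := (div_le_iff₀ (hg n hn)).2 (h n hn hge)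
    linarith [le_abs_self D, Finset.sum_nonneg hnn]

/-- Zelditch, quantitative estimate in the proof of Theorem 4.6.1: the time-averaged
off-diagonal pair correlation functional equals the Riemann sum
`(1/N) Σ_{ℓ≠0} f̂(2πℓ/N)` up to an error `O((log N)/N)`. -/
theorem time_averaged_off_diagonal_riemann_sum_estimate
    (φ : ℝ → ℝ) (C₁ : ℝ) (hC₁ : 0 < C₁)
    (hφ : ContDiffOn ℝ 1 φ (Set.Icc 0 1))
    (hφ' : ∀ x ∈ Set.Icc (0:ℝ) 1, C₁ ≤ |derivWithin φ (Set.Icc 0 1) x|)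
    (A : ℝ) (hA : 0 ≤ A) (ε : ℕ → ℝ → ℝ)
    (hε : ∀ N : ℕ, 1 ≤ N → ContDiffOn ℝ 1 (ε N) (Set.Icc 0 1))
    (hεbd : ∀ N : ℕ, 1 ≤ N → ∀ x ∈ Set.Icc (0:ℝ) 1,
      |ε N x| + |derivWithin (ε N) (Set.Icc 0 1) x| ≤ A / N)
    (f : SchwartzMap ℝ ℝ) (K : ℝ)
    (hf : Function.support (FT f) ⊆ Set.Icc (-K) K)
    (a b : ℝ) (hab : a < b) :
    ∃ C : ℝ, ∀ N : ℕ, 2 ≤ N →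
      ‖((1 / (b - a) : ℝ) : ℂ) * (∫ t in a..b,
          ((1 / (N : ℝ) ^ 2 : ℝ) : ℂ) * ∑' ℓ : ℤ, (if ℓ = 0 then 0 else
            FT f (2 * π * ℓ / N) *
              ((‖∑ j ∈ Finset.Icc 1 N, Complex.exp (Complex.I *
                  ((t * ℓ * N * (φ ((j : ℝ) / N) + ε N ((j : ℝ) / N)) : ℝ)
                    : ℂ))‖ ^ 2 : ℝ) : ℂ)))
        - ((1 / (N : ℝ) : ℝ) : ℂ) * ∑' ℓ : ℤ, (if ℓ = 0 then 0 else FT f (2 * π * ℓ / N))‖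
      ≤ C * Real.log N / N := by
  have hlog (N : ℕ) (hN : 2 ≤ N) : 0 < Real.log N :=
    Real.log_pos (by exact_mod_cast (by omega : 1 < N))
  simp only [mul_div_assoc _ (Real.log _)]
  set B : ℝ := ∫ x, |f x| with hB
  have hB0 : 0 ≤ B := integral_nonneg fun _ => abs_nonneg _
  set k : ℕ := ⌈|K|⌉₊ with hk
  refine exists_forall_le_mul_of_eventually
    (D := 32 * B / ((b - a) * C₁) * ((1 + Real.log k) / Real.log 2 + 1)) (n₁ := ⌈2 * A / C₁⌉₊)
    (fun N hN => div_pos (hlog N hN) (by positivity)) (fun _ => norm_nonneg _) fun N hN hN₁ => ?_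
  have hN1 : 1 ≤ N := by omega
  have hNpos : (0 : ℝ) < N := by positivity
  have hba : 0 < b - a := sub_pos.2 hab
  have hAN : A / N ≤ C₁ / 2 := by
    have := Nat.ceil_le.1 hN₁
    rw [div_le_iff₀ hC₁] at this
    rw [div_le_div_iff₀ hNpos two_pos]
    linarith
  set g : ℝ → ℝ := fun y => φ y + ε N y with hg
  have hφd := hφ.differentiableOn one_ne_zero
  have hεd := (hε N hN1).differentiableOn one_ne_zero
  have hgd : ∀ y ∈ Set.Icc (0 : ℝ) 1, C₁ / 2 ≤ |derivWithin g (Set.Icc 0 1) y| := by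
    intro y hy
    rw [hg, derivWithin_fun_add (hφd y hy) (hεd y hy)]
    have h1 := hφ' y hy
    have h2 := hεbd N hN1 y hy
    have h3 := abs_sub_abs_le_abs_sub (derivWithin φ (Set.Icc 0 1) y)
      (-derivWithin (ε N) (Set.Icc 0 1) y)
    rw [abs_neg, sub_neg_eq_add] at h3
    linarith [abs_nonneg (ε N y)]
  set S : ℤ → ℝ → ℝ := fun ℓ t => ‖∑ j ∈ Finset.Icc 1 N, Complex.exp (Complex.I *
    ((t * ℓ * N * (φ ((j : ℝ) / N) + ε N ((j : ℝ) / N)) : ℝ) : ℂ))‖ ^ 2 with hS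
  have hSint (ℓ : ℤ) (hℓ : ℓ ≠ 0) :
      |(∫ t in a..b, S ℓ t) - (b - a) * N| ≤ 16 * N / C₁ * |(ℓ : ℝ)|⁻¹ := by
    have hℓ' : (0 : ℝ) < |(ℓ : ℝ)| := abs_pos.2 (by exact_mod_cast hℓ)
    set x : Fin N → ℝ := fun j => ℓ * N * g (((j : ℕ) + 1 : ℕ) / N) with hx
    have hSx (t : ℝ) : S ℓ t = ‖∑ j, Complex.exp (Complex.I * ((t * x j : ℝ) : ℂ))‖ ^ 2 := by
      simp only [hS, hx]
      rw [sum_Icc_one_eq_sum_fin]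
      simp only [hg, mul_assoc]
    simp only [hSx]
    have hmem (j : Fin N) : (((j : ℕ) + 1 : ℕ) / N : ℝ) ∈ Set.Icc (0 : ℝ) 1 :=
      ⟨by positivity, (div_le_one hNpos).2 (by exact_mod_cast j.2)⟩
    refine (abs_integral_norm_sq_exp_sum_sub_le (δ := |(ℓ : ℝ)| * (C₁ / 2)) (by positivity)
      (fun r s => ?_) a b).trans (le_of_eq (by field_simp; ring))
    have h1 := mul_abs_sub_le_of_derivWithin (hφd.add hεd) hgd (hmem r) (hmem s)
    have h2 : (((r : ℕ) + 1 : ℕ) / N : ℝ) - ((s : ℕ) + 1 : ℕ) / N = ((r : ℝ) - s) / N := by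
      push_cast; ring
    rw [h2, abs_div, Nat.abs_cast] at h1
    simp only [hx]
    rw [← mul_sub, abs_mul, abs_mul, Nat.abs_cast]
    calc _ = |(ℓ : ℝ)| * N * (C₁ / 2 * (|(r : ℝ) - s| / N)) := by field_simp
      _ ≤ _ := mul_le_mul_of_nonneg_left h1 (by positivity)
  set T : Finset ℤ := Finset.Icc (-(k * N : ℕ) : ℤ) (k * N : ℕ) with hT
  set F : ℤ → ℂ := fun ℓ => if ℓ = 0 then 0 else FT f (2 * π * ℓ / N) with hF
  have hF0 (ℓ : ℤ) (hℓ : ℓ ∉ T) : F ℓ = 0 := by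
    simp only [hF, FT_eq_zero_of_natCast_lt hf hN1 hℓ, ite_self]
  have hFn (ℓ : ℤ) : ‖F ℓ‖ ≤ B := by
    simp only [hF]
    split_ifs
    · simpa using hB0
    · exact norm_FT_le _ _
  have hfun (t : ℝ) : ∑' ℓ : ℤ, (if ℓ = 0 then 0 else FT f (2 * π * ℓ / N) * (S ℓ t : ℂ)) =
      ∑ ℓ ∈ T, F ℓ * (S ℓ t : ℂ) := by
    have h1 (ℓ : ℤ) : (if ℓ = 0 then 0 else FT f (2 * π * ℓ / N) * (S ℓ t : ℂ)) =
        F ℓ * (S ℓ t : ℂ) := by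
      simp only [hF]; split_ifs <;> simp
    simp only [h1]
    exact tsum_eq_sum fun ℓ hℓ => by rw [hF0 ℓ hℓ, zero_mul]
  have hScont (ℓ : ℤ) : Continuous fun t => (S ℓ t : ℂ) := by
    simp only [hS]; fun_prop
  have hint : ∫ t in a..b, ((1 / (N : ℝ) ^ 2 : ℝ) : ℂ) *
      ∑' ℓ : ℤ, (if ℓ = 0 then 0 else FT f (2 * π * ℓ / N) * (S ℓ t : ℂ)) =
      ((1 / (N : ℝ) ^ 2 : ℝ) : ℂ) * ∑ ℓ ∈ T, F ℓ * ((∫ t in a..b, S ℓ t : ℝ) : ℂ) := by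
    simp only [hfun]
    rw [intervalIntegral.integral_const_mul, intervalIntegral.integral_finsetSum fun ℓ _ =>
      ((hScont ℓ).const_mul _).intervalIntegrable a b]
    simp only [intervalIntegral.integral_const_mul, intervalIntegral.integral_ofReal]
  have hsplit : ((1 / (b - a) : ℝ) : ℂ) * (((1 / (N : ℝ) ^ 2 : ℝ) : ℂ) *
      ∑ ℓ ∈ T, F ℓ * ((∫ t in a..b, S ℓ t : ℝ) : ℂ)) - ((1 / (N : ℝ) : ℝ) : ℂ) * ∑ ℓ ∈ T, F ℓ =
      ((1 / ((b - a) * N ^ 2) : ℝ) : ℂ) *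
        ∑ ℓ ∈ T, F ℓ * (((∫ t in a..b, S ℓ t) - (b - a) * N : ℝ) : ℂ) := by
    have h1 : ((b : ℂ) - a) ≠ 0 := by exact_mod_cast hba.ne'
    have h2 : (N : ℂ) ≠ 0 := by exact_mod_cast hNpos.ne'
    simp only [Complex.ofReal_sub _ ((b - a) * N), mul_sub, Finset.sum_sub_distrib,
      ← Finset.sum_mul]
    push_cast
    field_simp
  have htsum : ∑' ℓ : ℤ, F ℓ = ∑ ℓ ∈ T, F ℓ := tsum_eq_sum fun ℓ hℓ => hF0 ℓ hℓ
  have hbound : ∑ ℓ ∈ T, ‖F ℓ * (((∫ t in a..b, S ℓ t) - (b - a) * N : ℝ) : ℂ)‖ ≤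
      B * (16 * N / C₁) * (2 * (1 + Real.log (k * N : ℕ))) := by
    refine le_trans ?_ (mul_le_mul_of_nonneg_left (sum_inv_abs_Icc_neg (k * N)) (by positivity))
    rw [Finset.mul_sum]
    refine Finset.sum_le_sum fun ℓ _ => ?_
    rcases eq_or_ne ℓ 0 with rfl | hℓ
    · simp [hF]
    · rw [norm_mul, Complex.norm_real, Real.norm_eq_abs, mul_assoc B]
      exact mul_le_mul (hFn ℓ) (hSint ℓ hℓ) (abs_nonneg _) hB0
  have hlogkN : 1 + Real.log (k * N : ℕ) ≤
      ((1 + Real.log k) / Real.log 2 + 1) * Real.log N := by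
    have hl2 : 0 < Real.log 2 := Real.log_pos one_lt_two
    have hlN : Real.log 2 ≤ Real.log N :=
      Real.log_le_log two_pos (by exact_mod_cast hN)
    have hlk : 0 ≤ Real.log k := Real.log_natCast_nonneg k
    have h1 : 1 + Real.log k ≤ (1 + Real.log k) / Real.log 2 * Real.log N := by
      rw [div_mul_eq_mul_div, le_div_iff₀ hl2]
      exact mul_le_mul_of_nonneg_left hlN (by linarith)
    have h2 : Real.log (k * N : ℕ) ≤ Real.log k + Real.log N := by
      rcases Nat.eq_zero_or_pos k with h0 | h0
      · simpa [h0] using (hlog N hN).le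
      · rw [Nat.cast_mul, Real.log_mul (by positivity) hNpos.ne']
    linarith
  calc _ = ‖((1 / ((b - a) * N ^ 2) : ℝ) : ℂ) *
        ∑ ℓ ∈ T, F ℓ * (((∫ t in a..b, S ℓ t) - (b - a) * N : ℝ) : ℂ)‖ := by
        rw [← hsplit, ← hint, ← htsum]
    _ ≤ 1 / ((b - a) * N ^ 2) * (B * (16 * N / C₁) * (2 * (1 + Real.log (k * N : ℕ)))) := by
        rw [norm_mul, Complex.norm_real, Real.norm_of_nonneg (by positivity)]
        exact mul_le_mul_of_nonneg_left ((norm_sum_le _ _).trans hbound) (by positivity)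
    _ ≤ 1 / ((b - a) * N ^ 2) * (B * (16 * N / C₁) *
          (2 * (((1 + Real.log k) / Real.log 2 + 1) * Real.log N))) := by gcongr
    _ = _ := by field_simp; ring
end
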